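/- Let n > 4, 2 ≤ r ≤ n−2, and H = C(n,r+1;r) ⊆ S_n. Let L be an irreducible finite-dimensional complex S_n-module with dim L > n−1, and let λ be an eigenvalue of the action of H⁺ = Σ_{h∈H} h on L (all such eigenvalues are real since H = H⁻¹). Then λ ≤ r!·(n−r−1). -/

import Mathlib

open Equiv

/-- `C(n,k;r)` as a finset: the `k`-cycles in `S_n` moving every point of `{1,…,r}`. -/
noncomputable def movingCycles (n k r : ℕ) : Finset (Perm (Fin n)) := by
  classical
  exact Finset.univ.filter fun g => g.IsCycle ∧ g.support.card = k ∧
    ∀ i : Fin n, (i : ℕ) < r → i ∈ g.support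

section Cycles

variable {α : Type*} [Fintype α] [DecidableEq α]

/-- The cycles whose support is exactly `S`. -/
noncomputable def cyclesOn (S : Finset α) : Finset (Perm α) := by
  classical
  exact Finset.univ.filter fun g => g.IsCycle ∧ g.support = S

theorem mem_cyclesOn {S : Finset α} {g : Perm α} :
    g ∈ cyclesOn S ↔ g.IsCycle ∧ g.support = S := by
  simp [cyclesOn]

theorem cyclesOn_pair {a b : α} (hab : a ≠ b) : cyclesOn {a, b} = {swap a b} := by
  ext g
  rw [mem_cyclesOn, Finset.mem_singleton]
  constructor
  · rintro ⟨-, hg⟩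
    obtain ⟨x, y, hxy, rfl⟩ :=
      Perm.card_support_eq_two.1 (by rw [hg, Finset.card_pair hab])
    rw [Perm.support_swap hxy] at hg
    have hx : x ∈ ({a, b} : Finset α) := by rw [← hg]; simp
    have hy : y ∈ ({a, b} : Finset α) := by rw [← hg]; simp
    simp only [Finset.mem_insert, Finset.mem_singleton] at hx hy
    rcases hx with rfl | rfl <;> rcases hy with rfl | rfl
    · exact absurd rfl hxy
    · rfl
    · exact swap_comm _ _
    · exact absurd rfl hxy
  · rintro rfl
    exact ⟨Perm.isCycle_swap hab, Perm.support_swap hab⟩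

theorem swap_mul_mem_cyclesOn_insert {S : Finset α} {p i : α} (hp : p ∉ S) (hi : i ∈ S)
    {σ : Perm α} (hσ : σ ∈ cyclesOn S) : swap i p * σ ∈ cyclesOn (insert p S) := by
  obtain ⟨hc, rfl⟩ := mem_cyclesOn.1 hσ
  have hne : σ i ≠ i := Perm.mem_support.1 hi
  have hform : (σ.toList i).formPerm = σ := by
    rw [Perm.formPerm_toList, hc.cycleOf_eq hne]
  have hmem : ∀ y, y ∈ σ.toList i ↔ y ∈ σ.support := fun y => by
    rw [Perm.mem_toList_iff]
    refine ⟨fun h => h.1.mem_support_iff.1 h.2, fun h => ⟨?_, hi⟩⟩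
    exact hc.sameCycle hne (Perm.mem_support.1 h)
  have hnd := Perm.nodup_toList σ i
  obtain ⟨l, hl⟩ : ∃ l, σ.toList i = i :: l := by
    have h0 := Perm.toList_getElem_zero σ i hi
    cases h : σ.toList i with
    | nil => exact absurd hi (Perm.toList_eq_nil_iff.1 h)
    | cons a l => simp only [h, List.getElem_cons_zero] at h0; exact ⟨l, by rw [h0]⟩
  have heq : swap i p * σ = (p :: σ.toList i).formPerm := by
    rw [hl, List.formPerm_cons_cons, ← hl, hform, swap_comm]
  have hnd' : (p :: σ.toList i).Nodup :=
    List.nodup_cons.2 ⟨fun h => hp ((hmem p).1 h), hnd⟩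
  rw [mem_cyclesOn, heq]
  refine ⟨List.isCycle_formPerm hnd' (by simp [hl]), ?_⟩
  rw [List.support_formPerm_of_nodup _ hnd' (by simp [hl])]
  ext y
  simp [hmem]

theorem swap_mul_mem_cyclesOn {S : Finset α} (hS : 2 ≤ S.card) {p : α} (hp : p ∉ S)
    {h : Perm α} (hh : h ∈ cyclesOn (insert p S)) :
    h p ∈ S ∧ swap (h p) p * h ∈ cyclesOn S := by
  obtain ⟨hc, hs⟩ := mem_cyclesOn.1 hh
  have hps : p ∈ h.support := by rw [hs]; simp
  have hpne : h p ≠ p := Perm.mem_support.1 hps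
  have hcard : h.support.card = S.card + 1 := by rw [hs, Finset.card_insert_of_notMem hp]
  have hpp : h (h p) ≠ p := fun hpp => by
    have h2 := Perm.card_support_eq_two.2
      ⟨p, h p, hpne.symm, hc.eq_swap_of_apply_apply_eq_self hpne hpp⟩
    omega
  refine ⟨?_, mem_cyclesOn.2 ⟨?_, ?_⟩⟩
  · have : h p ∈ h.support := Perm.apply_mem_support.2 hps
    rw [hs] at this
    exact Finset.mem_of_mem_insert_of_ne this hpne
  · rw [swap_comm]; exact hc.swap_mul hpne hpp
  · rw [swap_comm, Perm.support_swap_mul_eq _ _ hpp, hs,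
      Finset.sdiff_singleton_eq_erase, Finset.erase_insert hp]

theorem sum_cyclesOn_insert {M : Type*} [AddCommMonoid M] {S : Finset α} (hS : 2 ≤ S.card)
    {p : α} (hp : p ∉ S) (f : Perm α → M) :
    ∑ h ∈ cyclesOn (insert p S), f h = ∑ i ∈ S, ∑ σ ∈ cyclesOn S, f (swap i p * σ) := by
  rw [← Finset.sum_product']
  refine Finset.sum_bij' (fun h _ => (h p, swap (h p) p * h)) (fun x _ => swap x.1 p * x.2)
    ?_ ?_ ?_ ?_ ?_
  · intro h hh
    exact Finset.mem_product.2 (swap_mul_mem_cyclesOn hS hp hh)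
  · intro x hx
    exact swap_mul_mem_cyclesOn_insert hp (Finset.mem_product.1 hx).1 (Finset.mem_product.1 hx).2
  · intro h hh
    simp
  · rintro ⟨i, σ⟩ hx
    obtain ⟨-, hσ⟩ := Finset.mem_product.1 hx
    have : σ p = p := by
      rw [← Perm.notMem_support, (mem_cyclesOn.1 hσ).2]; exact hp
    simp [this]
  · intro h hh
    simp

theorem conj_mem_cyclesOn {S : Finset α} {g : Perm α} (hg : ∀ i, g i ∈ S ↔ i ∈ S) {σ : Perm α}
    (hσ : σ ∈ cyclesOn S) : g * σ * g⁻¹ ∈ cyclesOn S := by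
  obtain ⟨hc, hs⟩ := mem_cyclesOn.1 hσ
  refine mem_cyclesOn.2 ⟨hc.conj, ?_⟩
  ext y
  rw [Perm.support_conj, hs, Finset.mem_map_equiv, ← hg]
  simp

end Cycles

section StarSum

variable {α : Type*} {E : Type*} [NormedAddCommGroup E]
  [InnerProductSpace ℂ E] (ρ : Representation ℂ (Perm α) E)

theorem rep_mul_apply (g h : Perm α) (x : E) : ρ (g * h) x = ρ g (ρ h x) := by
  rw [map_mul, Module.End.mul_apply]

theorem rep_swap_swap [DecidableEq α] (a b : α) (x : E) : ρ (swap a b) (ρ (swap a b) x) = x := by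
  rw [← rep_mul_apply, swap_mul_self, map_one, Module.End.one_apply]

theorem rep_swap_self [DecidableEq α] (a : α) (x : E) : ρ (swap a a) x = x := by
  rw [swap_self]
  exact congrArg (· x) (map_one ρ)

/-- `ρ` preserves the inner product. -/
def IsUnitaryRep : Prop := ∀ g x y, inner ℂ (ρ g x) (ρ g y) = inner ℂ x y

theorem IsUnitaryRep.norm_eq {ρ : Representation ℂ (Perm α) E} (hρ : IsUnitaryRep ρ) (g : Perm α) (x : E) : ‖ρ g x‖ = ‖x‖ := by
  have h := hρ g x x
  rw [inner_self_eq_norm_sq_to_K, inner_self_eq_norm_sq_to_K] at h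
  have h' : ‖ρ g x‖ ^ 2 = ‖x‖ ^ 2 := by exact_mod_cast h
  exact (sq_eq_sq₀ (norm_nonneg _) (norm_nonneg _)).1 h'

variable [DecidableEq α]

/-- The sum of the transpositions `(i p)`, `i ∈ S`, acting on a representation. -/
noncomputable def starSum (S : Finset α) (p : α) : E →ₗ[ℂ] E := ∑ i ∈ S, ρ (swap i p)

theorem starSum_apply (S : Finset α) (p : α) (x : E) :
    starSum ρ S p x = ∑ i ∈ S, ρ (swap i p) x := by
  simp [starSum]

theorem starSum_insert {S : Finset α} {q : α} (hq : q ∉ S) (p : α) (x : E) :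
    starSum ρ (insert q S) p x = ρ (swap q p) x + starSum ρ S p x := by
  rw [starSum_apply, Finset.sum_insert hq, starSum_apply]

theorem rep_starSum {S : Finset α} {p : α} {g : Perm α} (hg : ∀ i, g i ∈ S ↔ i ∈ S) (x : E) :
    ρ g (starSum ρ S p x) = starSum ρ S (g p) (ρ g x) := by
  rw [starSum_apply, starSum_apply, map_sum]
  refine Finset.sum_equiv g (fun i => (hg i).symm) fun i _ => ?_
  rw [← rep_mul_apply, ← rep_mul_apply, mul_swap_eq_swap_mul]

theorem swap_mem_iff {S : Finset α} {a b : α} (ha : a ∈ S) (hb : b ∈ S) (i : α) :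
    swap a b i ∈ S ↔ i ∈ S := by
  rw [swap_apply_def]
  split_ifs with h1 h2
  · simp [h1, ha, hb]
  · simp [h2, ha, hb]
  · rfl

variable {ρ}

theorem IsUnitaryRep.inner_swap (hρ : IsUnitaryRep ρ) (a b : α) (x y : E) :
    inner ℂ (ρ (swap a b) x) y = inner ℂ x (ρ (swap a b) y) := by
  rw [← hρ (swap a b) x, rep_swap_swap]

theorem IsUnitaryRep.norm_starSum_le (hρ : IsUnitaryRep ρ) (S : Finset α) (p : α) (x : E) :
    ‖starSum ρ S p x‖ ≤ S.card * ‖x‖ := by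
  rw [starSum_apply]
  refine (norm_sum_le _ _).trans ?_
  simp [hρ.norm_eq]

theorem IsUnitaryRep.starSum_isSymmetric (hρ : IsUnitaryRep ρ) (S : Finset α) (p : α) :
    (starSum ρ S p).IsSymmetric := fun x y => by
  simp only [starSum_apply, sum_inner, inner_sum, hρ.inner_swap]

theorem IsUnitaryRep.eq_zero_of_starSum_eq (hρ : IsUnitaryRep ρ) {S : Finset α} {p : α} {b : ℝ}
    (hb : (S.card : ℝ) < b) {x : E} (hx : starSum ρ S p x = (b : ℂ) • x) : x = 0 := by
  have h := hρ.norm_starSum_le S p x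
  have hb0 : 0 ≤ b := (Nat.cast_nonneg _).trans hb.le
  rw [hx, norm_smul, Complex.norm_real, Real.norm_of_nonneg hb0] at h
  by_contra hne
  have := norm_pos_iff.2 hne
  nlinarith

/-- An eigenvector of a star of transpositions with eigenvalue larger than `#S - 1` is fixed by
all of them. -/
theorem IsUnitaryRep.fixed_of_starSum_eq (hρ : IsUnitaryRep ρ) {S : Finset α} :
    ∀ {p : α}, p ∉ S → ∀ {b : ℝ}, (S.card : ℝ) - 1 < b → ∀ {v : E},
      starSum ρ S p v = (b : ℂ) • v → ∀ i ∈ S, ρ (swap i p) v = v := by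
  induction S using Finset.induction_on with
  | empty => simp
  | insert q S hq ih =>
    intro p hp b hb v hv
    have hqp : q ≠ p := fun h => hp (by simp [h])
    have hpS : p ∉ S := fun h => hp (by simp [h])
    rw [Finset.card_insert_of_notMem hq] at hb
    push_cast at hb
    have hb' : (S.card : ℝ) < b := by linarith
    have hswap : ∀ i, swap q p i ∈ S ↔ i ∈ S := fun i => by
      rw [swap_apply_def]
      split_ifs with h1 h2
      · simp [h1, hq, hpS]
      · simp [h2, hq, hpS]
      · rfl
    have hcomm : ∀ u, starSum ρ S q (starSum ρ (insert q S) p u) =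
        starSum ρ (insert q S) p (starSum ρ S q u) := fun u => by
      rw [starSum_apply, starSum_apply ρ S q u, map_sum]
      refine Finset.sum_congr rfl fun i hi => ?_
      have hip : p ≠ i := fun h => hpS (h ▸ hi)
      rw [rep_starSum ρ (swap_mem_iff (by simp [hi]) (by simp)),
        swap_apply_of_ne_of_ne hip hqp.symm]
    have hrel : ∀ u, ρ (swap q p) (starSum ρ (insert q S) p u) =
        u + starSum ρ S q (ρ (swap q p) u) := fun u => by
      rw [starSum_insert ρ hq, map_add, rep_swap_swap, rep_starSum ρ hswap, swap_apply_right]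
    have hJA : starSum ρ (insert q S) p (starSum ρ S q v) = (b : ℂ) • starSum ρ S q v := by
      rw [← hcomm, hv, map_smul]
    set s := ρ (swap q p) with hs
    set A := starSum ρ S q with hA
    obtain ⟨u, hu⟩ : ∃ u, u = (b : ℂ) • v - A v := ⟨_, rfl⟩
    have hJu : starSum ρ (insert q S) p u = (b : ℂ) • u := by
      rw [hu, map_sub, map_smul, hv, hJA, smul_sub]
    have hsu : A (s u) = (b : ℂ) • s u - u := by
      have h := hrel u
      rw [hJu, map_smul] at h
      rw [h]; abel
    have hw : s u - v = 0 := by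
      refine hρ.eq_zero_of_starSum_eq (p := q) hb' ?_
      rw [← hA, map_sub, hsu, hu, smul_sub]
      abel
    have hus : u = s v := by
      rw [← sub_eq_zero.1 hw, hs, rep_swap_swap]
    have hAv : A v = (b : ℂ) • v - s v := by rw [← hus, hu]; abel
    have hAsv : A (s v) = (b : ℂ) • s v - v := by
      have h := hrel v
      rw [hv, map_smul] at h
      rw [h]; abel
    have hminus : v - s v = 0 := by
      refine hρ.eq_zero_of_starSum_eq (p := q) (b := b + 1) (by linarith) ?_
      rw [← hA, map_sub, hAv, hAsv]
      push_cast
      module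
    have hsv : s v = v := (sub_eq_zero.1 hminus).symm
    have hfix := ih hq (b := b - 1) (by linarith) (v := v) (by
      rw [← hA, hAv, hsv]
      push_cast
      module)
    intro i hi
    rcases Finset.mem_insert.1 hi with rfl | hi
    · exact hsv
    · have hiq : i ≠ q := fun h => hq (h ▸ hi)
      have hip : i ≠ p := fun h => hpS (h ▸ hi)
      have hconj : swap i p = swap q p * swap i q * swap q p := by
        rw [swap_mul_swap_mul_swap hiq hip, swap_comm]
      rw [hconj, rep_mul_apply, rep_mul_apply, ← hs, hsv, hfix i hi, hsv]

/-- If no nonzero vector is fixed by every transposition, the star of transpositions centred at `p`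
is bounded by `n - 2` as a quadratic form. -/
theorem IsUnitaryRep.re_inner_starSum_le [Fintype α] [FiniteDimensional ℂ E]
    (hρ : IsUnitaryRep ρ) (hfix : ∀ x : E, (∀ a b, ρ (swap a b) x = x) → x = 0) (p : α) (x : E) :
    (inner ℂ (starSum ρ (Finset.univ.erase p) p x) x).re ≤
      ((Fintype.card α : ℝ) - 2) * ‖x‖ ^ 2 := by
  rcases eq_or_ne x 0 with rfl | hx
  · simp
  have : Nontrivial E := ⟨x, 0, hx⟩
  set J := starSum ρ (Finset.univ.erase p) p with hJ
  have hcard : ((Finset.univ.erase p).card : ℝ) = Fintype.card α - 1 := by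
    rw [Finset.card_erase_of_mem (Finset.mem_univ _), Finset.card_univ,
      Nat.cast_sub (Fintype.card_pos_iff.2 ⟨p⟩)]
    simp
  have hev := (hρ.starSum_isSymmetric (Finset.univ.erase p)
    p).hasEigenvalue_iSup_of_finiteDimensional
  rw [← hJ] at hev
  set μ : ℝ := ⨆ y : { y : E // y ≠ 0 }, RCLike.re (inner ℂ (J y) (y : E)) / ‖(y : E)‖ ^ 2 with hμ
  obtain ⟨v, hv⟩ := hev.exists_hasEigenvector
  have hμle : μ ≤ (Fintype.card α : ℝ) - 2 := by
    by_contra! hlt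
    refine hv.2 (hfix v ?_)
    have hstar : ∀ i, ρ (swap i p) v = v := fun i => by
      rcases eq_or_ne i p with rfl | hi
      · exact rep_swap_self ρ _ v
      · exact hρ.fixed_of_starSum_eq (Finset.notMem_erase p _) (b := μ) (by rw [hcard]; linarith)
          hv.apply_eq_smul i (by simp [hi])
    intro a b
    by_cases hab : a = b
    · subst hab; exact rep_swap_self ρ _ v
    by_cases hap : a = p
    · rw [hap, swap_comm]; exact hstar b
    rw [show swap a b = swap p b * swap a p * swap p b by
        rw [swap_mul_swap_mul_swap hap hab, swap_comm],
      rep_mul_apply, rep_mul_apply, swap_comm p b, hstar, hstar, hstar]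
  have hbdd : BddAbove (Set.range fun y : { y : E // y ≠ 0 } =>
      RCLike.re (inner ℂ (J y) (y : E)) / ‖(y : E)‖ ^ 2) := by
    refine ⟨(Finset.univ.erase p).card, ?_⟩
    rintro _ ⟨⟨y, hy⟩, rfl⟩
    have hpos := norm_pos_iff.2 hy
    rw [div_le_iff₀ (by positivity)]
    calc RCLike.re (inner ℂ (J y) y) ≤ ‖J y‖ * ‖y‖ := re_inner_le_norm _ _
      _ ≤ ((Finset.univ.erase p).card * ‖y‖) * ‖y‖ := by
          gcongr; exact hρ.norm_starSum_le _ _ _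
      _ = _ := by ring
  have hle := le_ciSup hbdd ⟨x, hx⟩
  have hpos := norm_pos_iff.2 hx
  rw [div_le_iff₀ (by positivity)] at hle
  calc _ ≤ μ * ‖x‖ ^ 2 := hle
    _ ≤ _ := by gcongr

end StarSum

section Semiinvariant

variable {α : Type*} [DecidableEq α] {E : Type*} [NormedAddCommGroup E]
  [InnerProductSpace ℂ E] (ρ : Representation ℂ (Perm α) E)

/-- All transpositions of points of `S` act on `x` as the scalar `ε`. -/
def IsSwapSemiinvariant (ε : ℂ) (S : Finset α) (x : E) : Prop :=
  ∀ a ∈ S, ∀ b ∈ S, a ≠ b → ρ (swap a b) x = ε • x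

variable {ρ}

theorem IsSwapSemiinvariant.add_starSum {ε : ℂ} (hε : ε * ε = 1) {S : Finset α} {p : α}
    (hp : p ∉ S) {x : E} (hx : IsSwapSemiinvariant ρ ε S x) :
    IsSwapSemiinvariant ρ ε (insert p S) (x + ε • starSum ρ S p x) := by
  have key : ∀ a ∈ S, ρ (swap a p) (x + ε • starSum ρ S p x) =
      ε • (x + ε • starSum ρ S p x) := by
    intro a ha
    have hsum : ∑ i ∈ S.erase a, ρ (swap a p) (ρ (swap i p) x) =
        ε • ∑ i ∈ S.erase a, ρ (swap i p) x := by
      rw [Finset.smul_sum]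
      refine Finset.sum_congr rfl fun i hi => ?_
      obtain ⟨hia, hiS⟩ := Finset.mem_erase.1 hi
      have hap : a ≠ p := fun h => hp (h ▸ ha)
      have hmul : swap a p * swap i p = swap i p * swap a i := by
        rw [mul_swap_eq_swap_mul (swap i p) a i, swap_apply_left,
          swap_apply_of_ne_of_ne hia.symm hap]
      rw [← rep_mul_apply, hmul, rep_mul_apply, hx a ha i hiS hia.symm, map_smul]
    rw [starSum_apply, ← Finset.add_sum_erase S _ ha, map_add, map_smul, map_add, map_sum,
      rep_swap_swap, hsum]
    simp only [smul_add, smul_smul, hε, one_smul]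
    module
  intro a ha b hb hab
  rcases Finset.mem_insert.1 ha with hap | ha' <;> rcases Finset.mem_insert.1 hb with hbp | hb'
  · exact absurd (hap.trans hbp.symm) hab
  · rw [hap, swap_comm]; exact key b hb'
  · rw [hbp]; exact key a ha'
  · have hpa : p ≠ a := fun h => hp (h ▸ ha')
    have hpb : p ≠ b := fun h => hp (h ▸ hb')
    rw [map_add, map_smul, rep_starSum ρ (swap_mem_iff ha' hb'),
      swap_apply_of_ne_of_ne hpa hpb, hx a ha' b hb' hab, map_smul, smul_add]

theorem IsSwapSemiinvariant.re_inner_starSum_ge (hρ : IsUnitaryRep ρ) {S : Finset α} {p : α}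
    (hp : p ∉ S) {x : E} (hx : IsSwapSemiinvariant ρ 1 S x) :
    -‖x‖ ^ 2 ≤ (inner ℂ (starSum ρ S p x) x).re := by
  have hy := hx.add_starSum (one_mul 1) hp
  rw [one_smul] at hy
  set y := x + starSum ρ S p x with hydef
  have h1 : inner ℂ y y = ((S.card + 1 : ℝ) : ℂ) * inner ℂ y x := by
    have hterm : ∀ i ∈ S, inner ℂ y (ρ (swap i p) x) = inner ℂ y x := fun i hi => by
      have hip : i ≠ p := fun h => hp (h ▸ hi)
      rw [← hρ.inner_swap, hy i (by simp [hi]) p (by simp) hip, one_smul]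
    conv_lhs => rw [hydef, ← hydef, inner_add_right, starSum_apply, inner_sum,
      Finset.sum_congr rfl hterm, Finset.sum_const, nsmul_eq_mul]
    push_cast
    ring
  have h2 : 0 ≤ (inner ℂ y y).re := inner_self_nonneg (𝕜 := ℂ)
  rw [h1, Complex.re_ofReal_mul] at h2
  have h3 : 0 ≤ (inner ℂ y x).re := nonneg_of_mul_nonneg_right h2 (by positivity)
  rw [hydef, inner_add_left, Complex.add_re] at h3
  have h4 : (inner ℂ x x).re = ‖x‖ ^ 2 := inner_self_eq_norm_sq (𝕜 := ℂ) x
  linarith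

variable [Fintype α]

theorem re_inner_of_sum_starSum_eq {R : Finset α} {x : E} {μ : ℝ}
    (hT : ∑ j ∈ Rᶜ, starSum ρ R j x = (μ : ℂ) • x) :
    ∑ j ∈ Rᶜ, (inner ℂ (starSum ρ R j x) x).re = μ * ‖x‖ ^ 2 := by
  have h := congrArg (fun y => (inner ℂ y x).re) hT
  simp only [sum_inner, inner_smul_left, Complex.conj_ofReal, Complex.re_ofReal_mul,
    Complex.re_sum] at h
  rw [h]
  congr 1
  exact inner_self_eq_norm_sq (𝕜 := ℂ) x

theorem IsSwapSemiinvariant.neg_card_compl_le (hρ : IsUnitaryRep ρ) {R : Finset α} {x : E}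
    (hx0 : x ≠ 0) (hx : IsSwapSemiinvariant ρ 1 R x) {μ : ℝ}
    (hT : ∑ j ∈ Rᶜ, starSum ρ R j x = (μ : ℂ) • x) : -(Rᶜ.card : ℝ) ≤ μ := by
  have h := re_inner_of_sum_starSum_eq hT
  have hle : ∑ _j ∈ Rᶜ, -‖x‖ ^ 2 ≤ ∑ j ∈ Rᶜ, (inner ℂ (starSum ρ R j x) x).re :=
    Finset.sum_le_sum fun j hj => hx.re_inner_starSum_ge hρ (Finset.mem_compl.1 hj)
  rw [h, Finset.sum_const, nsmul_eq_mul] at hle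
  have hpos : 0 < ‖x‖ ^ 2 := by have := norm_pos_iff.2 hx0; positivity
  refine le_of_mul_le_mul_right ?_ hpos
  linarith

theorem IsSwapSemiinvariant.le_card_mul [FiniteDimensional ℂ E] (hρ : IsUnitaryRep ρ)
    (hfix : ∀ x : E, (∀ a b, ρ (swap a b) x = x) → x = 0) {R : Finset α} (hR : R.Nonempty)
    {x : E} (hx0 : x ≠ 0) (hx : IsSwapSemiinvariant ρ 1 R x) {μ : ℝ}
    (hT : ∑ j ∈ Rᶜ, starSum ρ R j x = (μ : ℂ) • x) :
    μ ≤ R.card * ((Rᶜ.card : ℝ) - 1) := by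
  obtain ⟨p, hp⟩ := hR
  have h := re_inner_of_sum_starSum_eq hT
  have hpR : ∀ j ∈ Rᶜ, (inner ℂ (starSum ρ R j x) x).re =
      R.card * (inner ℂ (ρ (swap j p) x) x).re := fun j hj => by
    have hterm : ∀ i ∈ R, inner ℂ (ρ (swap i j) x) x = inner ℂ (ρ (swap j p) x) x := by
      intro i hi
      rcases eq_or_ne i p with rfl | hip
      · rw [swap_comm]
      have hji : j ≠ i := fun h => Finset.mem_compl.1 hj (h ▸ hi)
      have hjp : j ≠ p := fun h => Finset.mem_compl.1 hj (h ▸ hp)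
      have hmul : swap i p * swap j p = swap i j * swap i p := by
        rw [mul_swap_eq_swap_mul, swap_apply_right, swap_apply_of_ne_of_ne hji hjp, swap_comm j]
      have hxi : ρ (swap i p) x = x := by rw [hx i hi p hp hip, one_smul]
      calc inner ℂ (ρ (swap i j) x) x = inner ℂ (ρ (swap i j * swap i p) x) x := by
            rw [rep_mul_apply, hxi]
        _ = inner ℂ (ρ (swap j p) x) x := by
            rw [← hmul, rep_mul_apply, hρ.inner_swap, hxi]
    rw [starSum_apply, sum_inner, Finset.sum_congr rfl hterm, Finset.sum_const, nsmul_eq_mul]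
    simp
  rw [Finset.sum_congr rfl hpR, ← Finset.mul_sum] at h
  have hstar := hρ.re_inner_starSum_le hfix p x
  have hunion : Finset.univ.erase p = R.erase p ∪ Rᶜ := by
    ext i
    by_cases hi : i = p
    · simp [hi, hp]
    · simp [hi, em]
  have hdisj : Disjoint (R.erase p) Rᶜ :=
    Finset.disjoint_of_subset_left (Finset.erase_subset _ _) disjoint_compl_right
  have hsame : ∀ i ∈ R.erase p, (inner ℂ (ρ (swap i p) x) x).re = ‖x‖ ^ 2 := fun i hi => by
    obtain ⟨hip, hi⟩ := Finset.mem_erase.1 hi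
    rw [hx i hi p hp hip, one_smul]
    exact inner_self_eq_norm_sq (𝕜 := ℂ) x
  rw [starSum_apply, sum_inner, Complex.re_sum, hunion, Finset.sum_union hdisj,
    Finset.sum_congr rfl hsame, Finset.sum_const, nsmul_eq_mul, Finset.card_erase_of_mem hp,
    Nat.cast_sub (Finset.card_pos.2 ⟨p, hp⟩), Nat.cast_one, ← Finset.card_add_card_compl R,
    Nat.cast_add] at hstar
  have hpos : 0 < ‖x‖ ^ 2 := by have := norm_pos_iff.2 hx0; positivity
  refine le_of_mul_le_mul_right ?_ hpos
  rw [← h, mul_assoc]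
  gcongr
  linarith

end Semiinvariant

section CycleSum

variable {α : Type*} [Fintype α] [DecidableEq α] {E : Type*} [NormedAddCommGroup E]
  [InnerProductSpace ℂ E] (ρ : Representation ℂ (Perm α) E)

/-- The sum of the cycles with support `S`, acting on a representation. -/
noncomputable def cycleSum (S : Finset α) : E →ₗ[ℂ] E := ∑ σ ∈ cyclesOn S, ρ σ

theorem cycleSum_apply (S : Finset α) (x : E) :
    cycleSum ρ S x = ∑ σ ∈ cyclesOn S, ρ σ x := by
  simp [cycleSum]

theorem cycleSum_insert {S : Finset α} (hS : 2 ≤ S.card) {p : α} (hp : p ∉ S) (x : E) :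
    cycleSum ρ (insert p S) x = starSum ρ S p (cycleSum ρ S x) := by
  simp only [cycleSum_apply, starSum_apply, sum_cyclesOn_insert hS hp, map_sum, rep_mul_apply]
  exact Finset.sum_comm

theorem rep_cycleSum {S : Finset α} {g : Perm α} (hg : ∀ i, g i ∈ S ↔ i ∈ S) (x : E) :
    ρ g (cycleSum ρ S x) = cycleSum ρ S (ρ g x) := by
  rw [cycleSum_apply, cycleSum_apply, map_sum]
  have hg' : ∀ i, g⁻¹ i ∈ S ↔ i ∈ S := fun i => by rw [← hg]; simp
  refine Finset.sum_bij' (fun σ _ => g * σ * g⁻¹) (fun σ _ => g⁻¹ * σ * g⁻¹⁻¹)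
    (fun σ hσ => conj_mem_cyclesOn hg hσ) (fun σ hσ => conj_mem_cyclesOn hg' hσ)
    (fun σ _ => by group) (fun σ _ => by group) fun σ _ => ?_
  rw [← rep_mul_apply, ← rep_mul_apply, inv_mul_cancel_right]

variable {ρ}

theorem IsSwapSemiinvariant.cycleSum_eq {ε : ℂ} {S : Finset α} (hS : 2 ≤ S.card) {x : E}
    (hx : IsSwapSemiinvariant ρ ε S x) :
    cycleSum ρ S x = (ε ^ (S.card - 1) * ((S.card - 1).factorial : ℂ)) • x := by
  induction S using Finset.induction_on with
  | empty => simp at hS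
  | insert p S hp ih =>
    rw [Finset.card_insert_of_notMem hp] at hS
    rcases Nat.lt_or_ge S.card 2 with hlt | hge
    · obtain ⟨a, rfl⟩ := Finset.card_eq_one.1 (show S.card = 1 by omega)
      have hpa : p ≠ a := by simpa using hp
      rw [cycleSum_apply, cyclesOn_pair hpa, Finset.sum_singleton, hx p (by simp) a (by simp) hpa,
        Finset.card_pair hpa]
      simp
    · have hstar : starSum ρ S p x = ((S.card : ℂ) * ε) • x := by
        have hterm : ∀ i ∈ S, ρ (swap i p) x = ε • x := fun i hi =>
          hx i (by simp [hi]) p (by simp) fun h => hp (h ▸ hi)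
        rw [starSum_apply, Finset.sum_congr rfl hterm, Finset.sum_const, mul_smul,
          Nat.cast_smul_eq_nsmul]
      rw [cycleSum_insert ρ hge hp, ih hge fun a ha b hb => hx a (by simp [ha]) b (by simp [hb]),
        map_smul, hstar, smul_smul, Finset.card_insert_of_notMem hp]
      obtain ⟨k, hk⟩ : ∃ k, S.card = k + 1 := ⟨S.card - 1, by omega⟩
      rw [hk]
      simp only [Nat.add_sub_cancel, Nat.factorial_succ]
      push_cast
      ring_nf

theorem IsUnitaryRep.factorial_mul_norm_cycleSum_le (hρ : IsUnitaryRep ρ) {V : Finset α}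
    (hV : 2 ≤ V.card) (x : E) {U : Finset α} (hU : Disjoint U V) :
    ((V.card - 1).factorial : ℝ) * ‖cycleSum ρ (U ∪ V) x‖ ≤
      ((U ∪ V).card - 1).factorial * ‖cycleSum ρ V x‖ := by
  induction U using Finset.induction_on with
  | empty => simp
  | insert q U hq ih =>
    obtain ⟨hqV, hUV⟩ := Finset.disjoint_insert_left.1 hU
    have hqUV : q ∉ U ∪ V := by simp [hq, hqV]
    have hcard : 2 ≤ (U ∪ V).card := hV.trans (Finset.card_le_card Finset.subset_union_right)
    rw [Finset.insert_union, cycleSum_insert ρ hcard hqUV, Finset.card_insert_of_notMem hqUV]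
    obtain ⟨k, hk⟩ : ∃ k, (U ∪ V).card = k + 1 := ⟨(U ∪ V).card - 1, by omega⟩
    have hle := hρ.norm_starSum_le (U ∪ V) q (cycleSum ρ (U ∪ V) x)
    have hih := ih hUV
    rw [hk] at hle hih ⊢
    simp only [Nat.add_sub_cancel, Nat.factorial_succ] at hih ⊢
    push_cast at hle hih ⊢
    calc _ ≤ ((V.card - 1).factorial : ℝ) * ((k + 1) * ‖cycleSum ρ (U ∪ V) x‖) := by gcongr
      _ = (k + 1) * (((V.card - 1).factorial : ℝ) * ‖cycleSum ρ (U ∪ V) x‖) := by ring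
      _ ≤ (k + 1) * (k.factorial * ‖cycleSum ρ V x‖) := by gcongr
      _ = _ := by ring

end CycleSum

section CycleOp

variable {α : Type*} [Fintype α] [DecidableEq α] {E : Type*} [NormedAddCommGroup E]
  [InnerProductSpace ℂ E] (ρ : Representation ℂ (Perm α) E)

/-- The representation `ρ` tensored with the sign character. -/
noncomputable def signTwist : Representation ℂ (Perm α) E where
  toFun g := ((Perm.sign g : ℤ) : ℂ) • ρ g
  map_one' := by simp
  map_mul' g h := by
    rw [map_mul, map_mul, smul_mul_smul_comm]
    push_cast
    rfl

theorem signTwist_apply (g : Perm α) (x : E) :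
    signTwist ρ g x = ((Perm.sign g : ℤ) : ℂ) • ρ g x := rfl

theorem signTwist_swap {a b : α} (hab : a ≠ b) (x : E) :
    signTwist ρ (swap a b) x = -ρ (swap a b) x := by
  rw [signTwist_apply, Perm.sign_swap hab]
  simp

theorem starSum_signTwist {S : Finset α} {p : α} (hp : p ∉ S) (x : E) :
    starSum (signTwist ρ) S p x = -starSum ρ S p x := by
  rw [starSum_apply, starSum_apply, ← Finset.sum_neg_distrib]
  exact Finset.sum_congr rfl fun i hi =>
    signTwist_swap ρ (ne_of_mem_of_not_mem hi hp) x

variable {ρ} in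
theorem IsUnitaryRep.signTwist (hρ : IsUnitaryRep ρ) : IsUnitaryRep (signTwist ρ) :=
  fun g x y => by
    rw [signTwist_apply, signTwist_apply, inner_smul_left, inner_smul_right, hρ]
    rcases Int.units_eq_one_or (Perm.sign g) with h | h <;> simp [h]

/-- The sum of the cycles moving every point of `R` and exactly one further point. -/
noncomputable def cycleOp (R : Finset α) : E →ₗ[ℂ] E :=
  ∑ j ∈ Rᶜ, starSum ρ R j ∘ₗ cycleSum ρ R

theorem cycleOp_apply (R : Finset α) (x : E) :
    cycleOp ρ R x = ∑ j ∈ Rᶜ, starSum ρ R j (cycleSum ρ R x) := by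
  simp [cycleOp]

theorem rep_cycleOp {R : Finset α} {a b : α} (ha : a ∈ R) (hb : b ∈ R) (x : E) :
    ρ (swap a b) (cycleOp ρ R x) = cycleOp ρ R (ρ (swap a b) x) := by
  rw [cycleOp_apply, cycleOp_apply, map_sum]
  refine Finset.sum_congr rfl fun j hj => ?_
  have hj := Finset.mem_compl.1 hj
  rw [rep_starSum ρ (swap_mem_iff ha hb), rep_cycleSum ρ (swap_mem_iff ha hb),
    swap_apply_of_ne_of_ne (ne_of_mem_of_not_mem ha hj).symm (ne_of_mem_of_not_mem hb hj).symm]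

variable {ρ}

/-- The eigenvalue bound on vectors on which `Sym R` acts by a linear character. -/
theorem IsSwapSemiinvariant.eigenvalue_le [FiniteDimensional ℂ E] (hρ : IsUnitaryRep ρ)
    (hfix : ∀ x : E, (∀ a b, ρ (swap a b) x = x) → x = 0)
    (hsgn : ∀ x : E, (∀ a b, a ≠ b → ρ (swap a b) x = -x) → x = 0)
    {R : Finset α} (hR : 2 ≤ R.card) (hR' : 2 ≤ Rᶜ.card) {ε : ℂ} (hε : ε * ε = 1) {x : E}
    (hx0 : x ≠ 0) (hx : IsSwapSemiinvariant ρ ε R x) {lam : ℝ}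
    (hlam : cycleOp ρ R x = (lam : ℂ) • x) :
    lam ≤ R.card.factorial * ((Rᶜ.card : ℝ) - 1) := by
  have hne : R.Nonempty := Finset.card_pos.1 (by omega)
  obtain ⟨k, hk⟩ : ∃ k, R.card = k + 1 := ⟨R.card - 1, by omega⟩
  have hf : (k.factorial : ℂ) ≠ 0 := by exact_mod_cast k.factorial_ne_zero
  have hfpos : (0 : ℝ) < k.factorial := by exact_mod_cast k.factorial_pos
  have hC := hx.cycleSum_eq hR
  rw [hk, Nat.add_sub_cancel] at hC
  have hεk : ε ^ k * ε ^ k = 1 := by rw [← mul_pow, hε, one_pow]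
  have hT : ∑ j ∈ Rᶜ, starSum ρ R j x = (ε ^ k * (lam / k.factorial : ℝ) : ℂ) • x := by
    rw [cycleOp_apply, hC] at hlam
    simp only [map_smul, ← Finset.smul_sum] at hlam
    have h := congrArg (fun y => (ε ^ k * (k.factorial : ℂ)⁻¹) • y) hlam
    simp only [smul_smul] at h
    rw [show ε ^ k * (k.factorial : ℂ)⁻¹ * (ε ^ k * k.factorial) = 1 by
      rw [mul_mul_mul_comm, hεk, inv_mul_cancel₀ hf, one_mul], one_smul] at h
    rw [h]
    congr 1
    push_cast
    ring
  have hbound : lam / k.factorial ≤ R.card * ((Rᶜ.card : ℝ) - 1) := by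
    have hR2 : (2 : ℝ) ≤ R.card := by exact_mod_cast hR
    have hm2 : (2 : ℝ) ≤ Rᶜ.card := by exact_mod_cast hR'
    rcases mul_self_eq_one_iff.1 hε with rfl | rfl
    · rw [one_pow, one_mul] at hT
      exact hx.le_card_mul hρ hfix hne hx0 hT
    · have hx' : IsSwapSemiinvariant (signTwist ρ) 1 R x := fun a ha b hb hab => by
        rw [signTwist_swap ρ hab, hx a ha b hb hab]
        simp
      have hT' : ∑ j ∈ Rᶜ, starSum (signTwist ρ) R j x =
          (-((-1) ^ k * (lam / k.factorial : ℝ)) : ℂ) • x := by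
        rw [Finset.sum_congr rfl fun j hj => starSum_signTwist ρ (Finset.mem_compl.1 hj) x,
          Finset.sum_neg_distrib, hT, neg_smul]
      rcases Nat.even_or_odd k with hev | hodd
      · rw [hev.neg_one_pow, one_mul, ← Complex.ofReal_neg] at hT'
        have := hx'.neg_card_compl_le hρ.signTwist hx0 hT'
        nlinarith
      · rw [hodd.neg_one_pow, neg_one_mul, neg_neg] at hT'
        refine hx'.le_card_mul hρ.signTwist (fun y hy => hsgn y fun a b hab => ?_) hne hx0 hT'
        rw [← neg_eq_iff_eq_neg, ← signTwist_swap ρ hab]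
        exact hy a b
  rw [div_le_iff₀ hfpos] at hbound
  rw [hk, Nat.factorial_succ, ← hk]
  push_cast
  linarith

/-- The eigenvalue bound on vectors killed by symmetrisation from `S` to `insert p S`. -/
theorem IsUnitaryRep.eigenvalue_le_of_starSum_eq (hρ : IsUnitaryRep ρ) {R S : Finset α}
    (hSR : S ⊆ R) (hS : 2 ≤ S.card) (hR' : 2 ≤ Rᶜ.card) {p : α} (hpR : p ∈ R) (hpS : p ∉ S)
    {ε : ℂ} (hε : ε * ε = 1) {x : E} (hx0 : x ≠ 0) (hx : IsSwapSemiinvariant ρ ε S x)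
    (hp : starSum ρ S p x = -(ε • x)) {lam : ℝ} (hlam : cycleOp ρ R x = (lam : ℂ) • x) :
    lam ≤ R.card.factorial * ((Rᶜ.card : ℝ) - 1) := by
  have hεn : ‖ε‖ = 1 := by
    rcases mul_self_eq_one_iff.1 hε with rfl | rfl <;> simp
  have hxpos := norm_pos_iff.2 hx0
  obtain ⟨k, hk⟩ : ∃ k, S.card = k + 1 := ⟨S.card - 1, by omega⟩
  obtain ⟨r, hr⟩ : ∃ r, R.card = r + 1 :=
    ⟨R.card - 1, by have := Finset.card_pos.2 ⟨p, hpR⟩; omega⟩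
  have hV : ‖cycleSum ρ (insert p S) x‖ = k.factorial * ‖x‖ := by
    rw [cycleSum_insert ρ hS hpS, hx.cycleSum_eq hS, map_smul, hp, norm_smul, norm_neg,
      norm_smul, norm_mul, norm_pow, hεn, hk]
    simp
  have hsub : insert p S ⊆ R := Finset.insert_subset hpR hSR
  have hle := hρ.factorial_mul_norm_cycleSum_le (V := insert p S) (U := R \ insert p S)
    (by rw [Finset.card_insert_of_notMem hpS]; omega) x Finset.sdiff_disjoint
  rw [Finset.sdiff_union_of_subset hsub, hV, Finset.card_insert_of_notMem hpS,
    Nat.add_sub_cancel, hk, hr, Nat.add_sub_cancel, Nat.factorial_succ] at hle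
  push_cast at hle
  have hkpos : (0 : ℝ) < k.factorial := by exact_mod_cast k.factorial_pos
  have hk1 : (1 : ℝ) ≤ k := by
    have : 1 ≤ k := by omega
    exact_mod_cast this
  have hC : 2 * ‖cycleSum ρ R x‖ ≤ r.factorial * ‖x‖ := by
    refine le_of_mul_le_mul_left ?_ hkpos
    calc (k.factorial : ℝ) * (2 * ‖cycleSum ρ R x‖)
        ≤ k.factorial * ((k + 1) * ‖cycleSum ρ R x‖) := by gcongr; linarith
      _ ≤ _ := by linarith
  have hop : ‖cycleOp ρ R x‖ ≤ Rᶜ.card * (R.card * ‖cycleSum ρ R x‖) := by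
    rw [cycleOp_apply, ← nsmul_eq_mul]
    exact norm_sum_le_of_le _ (fun j _ => hρ.norm_starSum_le R j _) |>.trans (by simp)
  rw [hlam, norm_smul, Complex.norm_real, Real.norm_eq_abs] at hop
  have hm2 : (2 : ℝ) ≤ Rᶜ.card := by exact_mod_cast hR'
  refine le_of_mul_le_mul_right ?_ hxpos
  rw [hr] at hop
  rw [hr, Nat.factorial_succ]
  push_cast at hop ⊢
  calc lam * ‖x‖ ≤ |lam| * ‖x‖ := by gcongr; exact le_abs_self _
    _ ≤ Rᶜ.card * ((r + 1) * ‖cycleSum ρ R x‖) := hop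
    _ = (Rᶜ.card / 2) * (r + 1) * (2 * ‖cycleSum ρ R x‖) := by ring
    _ ≤ (Rᶜ.card / 2) * (r + 1) * (r.factorial * ‖x‖) := by gcongr
    _ = (Rᶜ.card / 2) * ((r + 1) * r.factorial * ‖x‖) := by ring
    _ ≤ (Rᶜ.card - 1) * ((r + 1) * r.factorial * ‖x‖) := by gcongr; linarith
    _ = _ := by ring

theorem IsUnitaryRep.eigenvalue_cycleOp_le [FiniteDimensional ℂ E] (hρ : IsUnitaryRep ρ)
    (hfix : ∀ x : E, (∀ a b, ρ (swap a b) x = x) → x = 0)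
    (hsgn : ∀ x : E, (∀ a b, a ≠ b → ρ (swap a b) x = -x) → x = 0)
    {R : Finset α} (hR : 2 ≤ R.card) (hR' : 2 ≤ Rᶜ.card) {x : E} (hx0 : x ≠ 0) {lam : ℝ}
    (hlam : cycleOp ρ R x = (lam : ℂ) • x) :
    lam ≤ R.card.factorial * ((Rᶜ.card : ℝ) - 1) := by
  classical
  let Good (S : Finset α) : Prop := 2 ≤ S.card ∧ ∃ (ε : ℂ) (y : E), ε * ε = 1 ∧ y ≠ 0 ∧
    cycleOp ρ R y = (lam : ℂ) • y ∧ IsSwapSemiinvariant ρ ε S y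
  have hgood : (R.powerset.filter Good).Nonempty := by
    obtain ⟨a, ha, b, hb, hab⟩ := Finset.one_lt_card.1 hR
    refine ⟨{a, b}, Finset.mem_filter.2 ⟨Finset.mem_powerset.2 ?_, by rw [Finset.card_pair hab], ?_⟩⟩
    · simp [Finset.insert_subset_iff, ha, hb]
    have hpair : ∀ (ε : ℂ), ε * ε = 1 → IsSwapSemiinvariant ρ ε {a, b}
        (x + ε • ρ (swap a b) x) := by
      intro ε hε c hc d hd hcd
      have hmain : ρ (swap a b) (x + ε • ρ (swap a b) x) = ε • (x + ε • ρ (swap a b) x) := by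
        rw [map_add, map_smul, rep_swap_swap, smul_add, smul_smul, hε, one_smul, add_comm]
      simp only [Finset.mem_insert, Finset.mem_singleton] at hc hd
      rcases hc with rfl | rfl <;> rcases hd with rfl | rfl
      · exact absurd rfl hcd
      · exact hmain
      · rw [swap_comm]; exact hmain
      · exact absurd rfl hcd
    have heig : ∀ ε : ℂ, cycleOp ρ R (x + ε • ρ (swap a b) x) =
        (lam : ℂ) • (x + ε • ρ (swap a b) x) := fun ε => by
      rw [map_add, map_smul, ← rep_cycleOp ρ ha hb, hlam, map_smul]
      module
    by_cases h : x + (1 : ℂ) • ρ (swap a b) x = 0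
    · refine ⟨-1, _, by norm_num, fun h' => hx0 ?_, heig _, hpair _ (by norm_num)⟩
      have h2 : (2 : ℂ) • x = 0 := by
        calc (2 : ℂ) • x = (x + (1 : ℂ) • ρ (swap a b) x) + (x + (-1 : ℂ) • ρ (swap a b) x) := by
              module
          _ = 0 := by rw [h, h', add_zero]
      exact (smul_eq_zero.1 h2).resolve_left two_ne_zero
    · exact ⟨1, _, by norm_num, h, heig _, hpair _ (by norm_num)⟩
  obtain ⟨S, hS, hmax⟩ := Finset.exists_max_image _ Finset.card hgood
  obtain ⟨hSR, hS2, ε, y, hε, hy0, hy, hyS⟩ := Finset.mem_filter.1 hS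
  rw [Finset.mem_powerset] at hSR
  by_cases hne : S = R
  · subst hne
    exact hyS.eigenvalue_le hρ hfix hsgn hR hR' hε hy0 hy
  obtain ⟨p, hpR, hpS⟩ := Finset.exists_of_ssubset (hSR.ssubset_of_ne hne)
  have hstar : cycleOp ρ R (starSum ρ S p y) = (lam : ℂ) • starSum ρ S p y := by
    rw [starSum_apply, map_sum, Finset.smul_sum]
    refine Finset.sum_congr rfl fun i hi => ?_
    rw [← rep_cycleOp ρ (hSR hi) hpR, hy, map_smul]
  have hzero : y + ε • starSum ρ S p y = 0 := by
    by_contra hne0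
    have hcard := hmax (insert p S) (Finset.mem_filter.2
      ⟨Finset.mem_powerset.2 (Finset.insert_subset hpR hSR),
        by rw [Finset.card_insert_of_notMem hpS]; omega, ε, _, hε, hne0,
        by rw [map_add, map_smul, hy, hstar]; module, hyS.add_starSum hε hpS⟩)
    rw [Finset.card_insert_of_notMem hpS] at hcard
    omega
  have hp : starSum ρ S p y = -(ε • y) := by
    have h := congrArg (ε • ·) hzero
    simp only [smul_add, smul_smul, hε, one_smul, smul_zero] at h
    exact eq_neg_of_add_eq_zero_right h
  exact hρ.eigenvalue_le_of_starSum_eq hSR hS2 hR' hpR hpS hε hy0 hyS hp hy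

end CycleOp

section Unitarizable

variable {G V : Type*} [Group G] [AddCommGroup V] [Module ℂ V]
  [FiniteDimensional ℂ V] (ρ : Representation ℂ G V)

/-- The matrix coefficients `g ↦ (ρ g x)ᵢ` of a vector with respect to a basis. -/
noncomputable def matrixCoeff :
    V →ₗ[ℂ] EuclideanSpace ℂ (G × Fin (Module.finrank ℂ V)) :=
  (WithLp.linearEquiv 2 ℂ (G × Fin (Module.finrank ℂ V) → ℂ)).symm.toLinearMap ∘ₗ
    LinearMap.pi fun q => (Module.finBasis ℂ V).coord q.2 ∘ₗ ρ q.1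

theorem matrixCoeff_apply (x : V) (q : G × Fin (Module.finrank ℂ V)) :
    matrixCoeff ρ x q = (Module.finBasis ℂ V).repr (ρ q.1 x) q.2 := rfl

theorem matrixCoeff_injective : Function.Injective (matrixCoeff ρ) := by
  rw [injective_iff_map_eq_zero]
  intro x hx
  apply (Module.finBasis ℂ V).repr.map_eq_zero_iff.1
  ext i
  have h := matrixCoeff_apply ρ x (1, i)
  rw [hx, map_one] at h
  exact h.symm

variable [Fintype G]

theorem inner_matrixCoeff (h : G) (x y : V) :
    inner ℂ (matrixCoeff ρ (ρ h x)) (matrixCoeff ρ (ρ h y)) =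
      inner ℂ (matrixCoeff ρ x) (matrixCoeff ρ y) := by
  simp only [PiLp.inner_apply, matrixCoeff_apply]
  refine Fintype.sum_equiv ((Equiv.mulRight h).prodCongr (Equiv.refl _)) _ _ fun q => ?_
  simp [map_mul]

/-- An inner product on `V` invariant under the finite group `G`. -/
noncomputable abbrev invariantInnerCore : InnerProductSpace.Core ℂ V where
  inner x y := inner ℂ (matrixCoeff ρ x) (matrixCoeff ρ y)
  conj_inner_symm x y := inner_conj_symm _ _
  re_inner_nonneg x := inner_self_nonneg
  add_left x y z := by rw [map_add, inner_add_left]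
  smul_left x y c := by rw [map_smul, inner_smul_left]
  definite x hx := matrixCoeff_injective ρ (by rw [inner_self_eq_zero.1 hx, map_zero])

end Unitarizable

/-- Points fixed up to a sign by all transpositions span an invariant line. -/
theorem eq_zero_of_swap_eigenvector {α L : Type*} [Finite α] [DecidableEq α] [AddCommGroup L]
    [Module ℂ L] (ρ : Representation ℂ (Perm α) L)
    (hirr : ∀ p : Submodule ℂ L, (∀ g, ∀ x ∈ p, ρ g x ∈ p) → p = ⊥ ∨ p = ⊤)
    (hdim : 1 < Module.finrank ℂ L) {ε : ℂ} {x : L}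
    (hx : ∀ a b, a ≠ b → ρ (swap a b) x = ε • x) : x = 0 := by
  have hstable : ∀ g, ρ g x ∈ Submodule.span ℂ {x} := by
    intro g
    induction g using Perm.swap_induction_on with
    | one => simp [Submodule.mem_span_singleton_self]
    | swap_mul f a b hab ih =>
      obtain ⟨c, hc⟩ := Submodule.mem_span_singleton.1 ih
      rw [map_mul, Module.End.mul_apply, ← hc, map_smul, hx a b hab, smul_smul]
      exact Submodule.mem_span_singleton.2 ⟨_, rfl⟩
  rcases hirr (Submodule.span ℂ {x}) (fun g y hy => by
    obtain ⟨c, rfl⟩ := Submodule.mem_span_singleton.1 hy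
    rw [map_smul]
    exact Submodule.smul_mem _ _ (hstable g)) with h | h
  · exact Submodule.span_singleton_eq_bot.1 h
  · have h1 : Module.finrank ℂ (Submodule.span ℂ {x}) ≤ 1 :=
      (finrank_span_le_card _).trans (by simp)
    rw [h, finrank_top] at h1
    omega

theorem sum_movingCycles {n r : ℕ} (hr : 2 ≤ r) {R : Finset (Fin n)} (hRcard : R.card = r)
    (hR : ∀ i, i ∈ R ↔ (i : ℕ) < r) {M : Type*} [AddCommMonoid M] (f : Perm (Fin n) → M) :
    ∑ h ∈ movingCycles n (r + 1) r, f h =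
      ∑ j ∈ Rᶜ, ∑ a ∈ R, ∑ σ ∈ cyclesOn R, f (swap a j * σ) := by
  have hbi : movingCycles n (r + 1) r = Rᶜ.biUnion fun j => cyclesOn (insert j R) := by
    ext g
    simp only [movingCycles, Finset.mem_filter, Finset.mem_univ, true_and, Finset.mem_biUnion,
      Finset.mem_compl, mem_cyclesOn]
    constructor
    · rintro ⟨hc, hcard, hmove⟩
      obtain ⟨j, hj, hins⟩ := Finset.exists_eq_insert_iff.2
        ⟨fun i hi => hmove i ((hR i).1 hi), show R.card + 1 = g.support.card by omega⟩
      exact ⟨j, hj, hc, hins.symm⟩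
    · rintro ⟨j, hj, hc, hs⟩
      refine ⟨hc, by rw [hs, Finset.card_insert_of_notMem hj, hRcard], fun i hi => ?_⟩
      rw [hs]
      exact Finset.mem_insert_of_mem ((hR i).2 hi)
  rw [hbi, Finset.sum_biUnion]
  · exact Finset.sum_congr rfl fun j hj =>
      sum_cyclesOn_insert (hRcard ▸ hr) (Finset.mem_compl.1 hj) f
  · intro j hj j' hj' hne
    rw [Function.onFun, Finset.disjoint_left]
    intro g hg hg'
    have heq : insert j R = insert j' R :=
      (mem_cyclesOn.1 hg).2.symm.trans (mem_cyclesOn.1 hg').2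
    have hmem : j ∈ insert j' R := by rw [← heq]; simp
    rcases Finset.mem_insert.1 hmem with h | h
    · exact hne h
    · exact Finset.mem_compl.1 hj h

/-- Let `n > 4`, `2 ≤ r ≤ n-2`, `H = C(n,r+1;r) ⊆ S_n`, and let `L` be an irreducible
finite-dimensional complex `S_n`-module with `dim L > n-1`.  Then every (real) eigenvalue
`λ` of `H⁺` on `L` satisfies `λ ≤ r!·(n-r-1)`. -/
theorem stmt19 (n r : ℕ) (hn : 4 < n) (hr : 2 ≤ r) (hrn : r ≤ n - 2)
    {L : Type*} [AddCommGroup L] [Module ℂ L] [FiniteDimensional ℂ L] [Nontrivial L]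
    (ρ : Representation ℂ (Perm (Fin n)) L)
    (hirr : ∀ p : Submodule ℂ L, (∀ g : Perm (Fin n), ∀ x ∈ p, ρ g x ∈ p) →
      p = ⊥ ∨ p = ⊤)
    (hdim : n - 1 < Module.finrank ℂ L)
    (lam : ℝ) (x : L) (hx : x ≠ 0)
    (heig : ∑ h ∈ movingCycles n (r + 1) r, ρ h x = (lam : ℂ) • x) :
    lam ≤ ((r.factorial * (n - r - 1) : ℕ) : ℝ) := by
  have hdim1 : 1 < Module.finrank ℂ L := by omega
  have hfix : ∀ x : L, (∀ a b, ρ (swap a b) x = x) → x = 0 := fun x h =>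
    eq_zero_of_swap_eigenvector ρ hirr hdim1 (ε := 1) fun a b _ => by rw [h, one_smul]
  have hsgn : ∀ x : L, (∀ a b, a ≠ b → ρ (swap a b) x = -x) → x = 0 := fun x h =>
    eq_zero_of_swap_eigenvector ρ hirr hdim1 (ε := -1) fun a b hab => by
      rw [h a b hab, neg_one_smul]
  set R : Finset (Fin n) := Finset.univ.filter fun i => (i : ℕ) < r with hRdef
  have hR : R.card = r := by rw [hRdef, Fin.card_filter_val_lt]; omega
  have hRc : Rᶜ.card = n - r := by rw [Finset.card_compl, Fintype.card_fin, hR]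
  rw [sum_movingCycles hr hR (by simp [hRdef])] at heig
  let _ : NormedAddCommGroup L := (invariantInnerCore ρ).toNormedAddCommGroup
  let _ : InnerProductSpace ℂ L :=
    InnerProductSpace.ofCore (invariantInnerCore ρ).toCore
  have hρ : IsUnitaryRep ρ := fun g x y => inner_matrixCoeff ρ g x y
  have hop : cycleOp ρ R x = (lam : ℂ) • x := by
    rw [← heig]
    simp only [cycleOp_apply, starSum_apply, cycleSum_apply, map_sum, rep_mul_apply]
    exact Finset.sum_congr rfl fun j _ => Finset.sum_comm
  have hle := hρ.eigenvalue_cycleOp_le hfix hsgn (by omega) (by omega) hx hop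
  rw [hR, hRc] at hle
  rw [Nat.cast_mul, Nat.cast_sub (show 1 ≤ n - r by omega), Nat.cast_one]
  exact hle
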